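/- Let d ∈ (0,1), l > 0, let F ∈ SR_d^{⌊l+d⌋+2}(0+), set f = F^{(0,1)}, let g : [0,∞) → ℝ be càdlàg, let t ∈ (0,1), let ε ∈ (0,l), and let P be a polynomial of degree at most ⌊l⌋ such that |g(r) − P(r)| ≤ C₀|r−t|^{l−ε} for all r ∈ [0,1] and some C₀ > 0. Then there exist h ∈ (0,t) and constants C > 0, h' > 0 such that for each δ ∈ (0,h') there is a polynomial P⁴ of degree at most ⌊l+d⌋ with |∫_{t−h}^{t−δ} (f(u,r) − f(v,r))[g(r) − P(r)]dr − P⁴(u) + P⁴(v)| ≤ C·F(u,v)·(|u−t|^{l−ε} + |v−t|^{l−ε}) for all u,v ∈ (t, t+h') with u − v = δ. -/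

import Mathlib

open Set Filter MeasureTheory intervalIntegral Polynomial Metric
open scoped Topology

noncomputable section

/-- Mixed partial derivative `F^{(n,m)}`: `n` derivatives in the first (time) variable
and `m` derivatives in the second variable. -/
noncomputable def pderiv2 (n m : ℕ) (F : ℝ → ℝ → ℝ) : ℝ → ℝ → ℝ :=
  fun s r => iteratedDeriv m (fun r' => iteratedDeriv n (fun s' => F s' r') s) r

/-- The closed half-plane `E = {(s,r) : r ≤ s}`. -/
def Ebar : Set (ℝ × ℝ) := {p | p.2 ≤ p.1}

/-- The open half-plane `Ẽ = {(s,r) : r < s}`. -/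
def Etil : Set (ℝ × ℝ) := {p | p.2 < p.1}

/-- Membership in `C₊^{(k)}(E)` : continuous on `E`, `k` times continuously
differentiable on `Ẽ`, and strictly positive on `Ẽ`. -/
structure CPlus (k : ℕ) (F : ℝ → ℝ → ℝ) : Prop where
  cont : ContinuousOn (fun p : ℝ × ℝ => F p.1 p.2) Ebar
  smooth : ContDiffOn ℝ k (fun p : ℝ × ℝ => F p.1 p.2) Etil
  pos : ∀ p ∈ Etil, 0 < F p.1 p.2

/-- `F` is a function of smooth variation of index `(ρ, k)` at the diagonal,
i.e. `F ∈ SR_ρ^k(0+)`. -/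
structure SmoothVariation (ρ : ℝ) (k : ℕ) (F : ℝ → ℝ → ℝ) : Prop where
  mem : CPlus k F
  condA : ∀ K : Set ℝ, IsCompact K → ∀ ε > 0, ∃ h₀ > 0, ∀ h : ℝ, 0 < h → h < h₀ →
    ∀ t ∈ K, |h * pderiv2 0 1 F t (t - h) / F t (t - h) + ρ| < ε
  condB : ∀ K : Set ℝ, IsCompact K → ∀ ε > 0, ∃ h₀ > 0, ∀ h : ℝ, 0 < h → h < h₀ →
    ∀ t ∈ K, |h * pderiv2 1 0 F (t + h) t / F (t + h) t - ρ| < ε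
  condC : ∀ j : ℕ, 2 ≤ j → j ≤ k → ∀ K : Set ℝ, IsCompact K → ∀ ε > 0, ∃ h₀ > 0,
    ∀ h : ℝ, 0 < h → h < h₀ → ∀ t ∈ K,
      |h ^ j * pderiv2 (j - 1) 1 F t (t - h) / F t (t - h)
        + ∏ i ∈ Finset.range j, (ρ - (i : ℝ))| < ε
  condD : ∀ K : Set ℝ, IsCompact K → ∀ ε > 0, ∃ h₀ > 0, ∀ h : ℝ, 0 < h → h < h₀ →
    ∀ t ∈ K, |h ^ 2 * pderiv2 0 2 F t (t - h) / F t (t - h) - ρ * (ρ - 1)| < ε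

/-- The 2-microlocal space with gauge function `F`, `C_F^{d,s'}(t₀)`. -/
def MemCF (F : ℝ → ℝ → ℝ) (d s' t₀ : ℝ) (g : ℝ → ℝ) : Prop :=
  ∃ C > 0, ∃ h > 0, ∃ P : Polynomial ℝ, (P.natDegree : ℤ) ≤ ⌊d - s'⌋ ∧
    ∀ u v : ℝ, u ∈ Metric.ball t₀ h → v ∈ Metric.ball t₀ h → v ≤ u →
      |(g u - P.eval u) - (g v - P.eval v)| ≤
        C * F u v * (|u - t₀| + |v - t₀|) ^ (-s')

/-- The classical 2-microlocal space `C^{σ,s'}(t₀)`. -/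
def MemC2ML (σ s' t₀ : ℝ) (g : ℝ → ℝ) : Prop :=
  ∃ C > 0, ∃ h > 0, ∃ P : Polynomial ℝ, (P.natDegree : ℤ) ≤ ⌊σ - s'⌋ ∧
    ∀ u v : ℝ, u ∈ Metric.ball t₀ h → v ∈ Metric.ball t₀ h →
      |(g u - P.eval u) - (g v - P.eval v)| ≤
        C * |u - v| ^ σ * (|u - t₀| + |v - t₀|) ^ (-s')

/-- The pointwise Hölder space `C^l(t₀)`. -/
def PtwHolder (l t₀ : ℝ) (g : ℝ → ℝ) : Prop :=
  ∃ C > 0, ∃ h > 0, ∃ P : Polynomial ℝ, (P.natDegree : ℤ) ≤ ⌊l⌋ ∧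
    ∀ t ∈ Metric.ball t₀ h, |g t - P.eval t| ≤ C * |t - t₀| ^ l

/-- The pointwise Hölder exponent `h_g(t₀) = sup{l : g ∈ C^l(t₀)}`. -/
def holderExp (g : ℝ → ℝ) (t₀ : ℝ) : ℝ := sSup {l | PtwHolder l t₀ g}

/-- The Hölder exponent with gauge function `F`,
`h̄^d_g(t₀) = d − inf{s' ≤ 0 : g ∈ C_F^{d,s'}(t₀)}`. -/
def holderGaugeExp (F : ℝ → ℝ → ℝ) (d : ℝ) (g : ℝ → ℝ) (t₀ : ℝ) : ℝ :=
  d - sInf {s' | s' ≤ 0 ∧ MemCF F d s' t₀ g}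

/-- The 2-microlocal frontier `σ_{g,t₀}(s') = sup{σ ∈ [0,1) : g ∈ C^{σ,s'}(t₀)}`. -/
def frontier2ML (g : ℝ → ℝ) (t₀ s' : ℝ) : ℝ :=
  sSup {σ | σ ∈ Set.Ico (0:ℝ) 1 ∧ MemC2ML σ s' t₀ g}

/-- `g` is càdlàg on `[0,∞)`: right-continuous with left limits. -/
def CadlagOn (g : ℝ → ℝ) : Prop :=
  (∀ t : ℝ, 0 ≤ t → Tendsto g (𝓝[Set.Ici t] t) (𝓝 (g t))) ∧
  (∀ t : ℝ, 0 < t → ∃ L : ℝ, Tendsto g (𝓝[Set.Iio t] t) (𝓝 L))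

/-- Partial derivative in the first variable. -/
def D1 (G : ℝ × ℝ → ℝ) : ℝ × ℝ → ℝ := fun p => fderiv ℝ G p (1, 0)

/-- Partial derivative in the second variable. -/
def D2 (G : ℝ × ℝ → ℝ) : ℝ × ℝ → ℝ := fun p => fderiv ℝ G p (0, 1)

lemma isOpen_Etil : IsOpen Etil := isOpen_lt continuous_snd continuous_fst

lemma contDiffOn_D1 {G : ℝ × ℝ → ℝ} {n : ℕ} (h : ContDiffOn ℝ ((n + 1 : ℕ)) G Etil) :
    ContDiffOn ℝ n (D1 G) Etil := by
  have := h.fderiv_of_isOpen (m := n) isOpen_Etil (by norm_cast)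
  exact this.clm_apply contDiffOn_const

lemma contDiffOn_D2 {G : ℝ × ℝ → ℝ} {n : ℕ} (h : ContDiffOn ℝ ((n + 1 : ℕ)) G Etil) :
    ContDiffOn ℝ n (D2 G) Etil := by
  have := h.fderiv_of_isOpen (m := n) isOpen_Etil (by norm_cast)
  exact this.clm_apply contDiffOn_const

lemma contDiffOn_D1_iter {G : ℝ × ℝ → ℝ} (j : ℕ) : ∀ {n : ℕ},
    ContDiffOn ℝ ((n + j : ℕ)) G Etil → ContDiffOn ℝ n (D1^[j] G) Etil := by
  induction j with
  | zero => intro n h; simpa using h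
  | succ j ih =>
    intro n h
    rw [Function.iterate_succ_apply']
    apply contDiffOn_D1
    apply ih
    convert h using 2
    ring

lemma hasDerivAt_D1 {G : ℝ × ℝ → ℝ} {n : ℕ} (h : ContDiffOn ℝ ((n + 1 : ℕ)) G Etil)
    {s r : ℝ} (hr : r < s) : HasDerivAt (fun x => G (x, r)) (D1 G (s, r)) s := by
  have hm : Etil ∈ 𝓝 (s, r) := isOpen_Etil.mem_nhds hr
  have hd : DifferentiableAt ℝ G (s, r) :=
    (h.contDiffAt hm).differentiableAt (by simp)
  have h2 : HasDerivAt (fun x : ℝ => (x, r)) ((1 : ℝ), (0 : ℝ)) s :=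
    (hasDerivAt_id s).prodMk (hasDerivAt_const s r)
  exact hd.hasFDerivAt.comp_hasDerivAt s h2

lemma hasDerivAt_D2 {G : ℝ × ℝ → ℝ} {n : ℕ} (h : ContDiffOn ℝ ((n + 1 : ℕ)) G Etil)
    {s r : ℝ} (hr : r < s) : HasDerivAt (fun x => G (s, x)) (D2 G (s, r)) r := by
  have hm : Etil ∈ 𝓝 (s, r) := isOpen_Etil.mem_nhds hr
  have hd : DifferentiableAt ℝ G (s, r) :=
    (h.contDiffAt hm).differentiableAt (by simp)
  have h2 : HasDerivAt (fun x : ℝ => (s, x)) ((0 : ℝ), (1 : ℝ)) r :=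
    (hasDerivAt_const r s).prodMk (hasDerivAt_id r)
  exact hd.hasFDerivAt.comp_hasDerivAt r h2

lemma D1_D2_comm {G : ℝ × ℝ → ℝ} (h : ContDiffOn ℝ ((2 : ℕ)) G Etil)
    {s r : ℝ} (hr : r < s) : D1 (D2 G) (s, r) = D2 (D1 G) (s, r) := by
  have hm : Etil ∈ 𝓝 (s, r) := isOpen_Etil.mem_nhds hr
  have hc := h.contDiffAt hm
  have hs : IsSymmSndFDerivAt ℝ G (s, r) := hc.isSymmSndFDerivAt (by simp)
  have hd : DifferentiableAt ℝ (fderiv ℝ G) (s, r) :=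
    (hc.fderiv_right (m := 1) (by norm_num)).differentiableAt (by simp)
  have key : ∀ a b : ℝ × ℝ, fderiv ℝ (fun p => fderiv ℝ G p a) (s, r) b
      = fderiv ℝ (fderiv ℝ G) (s, r) b a := by
    intro a b
    have := (hd.hasFDerivAt.clm_apply (hasFDerivAt_const a (s, r))).fderiv
    rw [this]
    simp
  unfold D1 D2
  rw [key, key]
  exact hs.eq _ _

lemma iteratedDeriv_eq_D1 {F : ℝ → ℝ → ℝ} (j : ℕ) :
    ContDiffOn ℝ (j : ℕ) (fun p : ℝ × ℝ => F p.1 p.2) Etil → ∀ s r : ℝ, r < s →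
    iteratedDeriv j (fun s' => F s' r) s = D1^[j] (fun p : ℝ × ℝ => F p.1 p.2) (s, r) := by
  induction j with
  | zero => intro h s r hr; simp
  | succ j ih =>
    intro h s r hr
    have h' := ih (h.of_le (by norm_cast; omega))
    rw [iteratedDeriv_succ, Function.iterate_succ_apply']
    have hc : ContDiffOn ℝ ((0 + 1 : ℕ)) (D1^[j] (fun p : ℝ × ℝ => F p.1 p.2)) Etil := by
      apply contDiffOn_D1_iter
      convert h using 2
      ring
    rw [← (hasDerivAt_D1 hc hr).deriv]
    apply Filter.EventuallyEq.deriv_eq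
    filter_upwards [lt_mem_nhds hr] with x hx
    exact h' x r hx

lemma pderiv2_eq {F : ℝ → ℝ → ℝ} (j : ℕ)
    (h : ContDiffOn ℝ ((j + 1 : ℕ)) (fun p : ℝ × ℝ => F p.1 p.2) Etil) {s r : ℝ} (hr : r < s) :
    pderiv2 j 1 F s r = D2 (D1^[j] (fun p : ℝ × ℝ => F p.1 p.2)) (s, r) := by
  unfold pderiv2
  rw [iteratedDeriv_one]
  have hc : ContDiffOn ℝ ((0 + 1 : ℕ)) (D1^[j] (fun p : ℝ × ℝ => F p.1 p.2)) Etil := by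
    apply contDiffOn_D1_iter
    convert h using 2
    ring
  rw [← (hasDerivAt_D2 hc hr).deriv]
  apply Filter.EventuallyEq.deriv_eq
  filter_upwards [gt_mem_nhds hr] with x hx
  exact iteratedDeriv_eq_D1 j (h.of_le (by norm_cast; omega)) s x hx

lemma pderiv2_hasDerivAt {F : ℝ → ℝ → ℝ} (j : ℕ)
    (h : ContDiffOn ℝ ((j + 2 : ℕ)) (fun p : ℝ × ℝ => F p.1 p.2) Etil) {s r : ℝ} (hr : r < s) :
    HasDerivAt (fun x => pderiv2 j 1 F x r) (pderiv2 (j + 1) 1 F s r) s := by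
  have hc : ContDiffOn ℝ ((2 : ℕ)) (D1^[j] (fun p : ℝ × ℝ => F p.1 p.2)) Etil := by
    apply contDiffOn_D1_iter
    convert h using 2
    ring
  have h1 : HasDerivAt (fun x => D2 (D1^[j] (fun p : ℝ × ℝ => F p.1 p.2)) (x, r))
      (D1 (D2 (D1^[j] (fun p : ℝ × ℝ => F p.1 p.2))) (s, r)) s :=
    hasDerivAt_D1 (n := 0) (contDiffOn_D2 hc) hr
  rw [D1_D2_comm hc hr, ← Function.iterate_succ_apply' D1, ← pderiv2_eq (j + 1) h hr] at h1
  refine h1.congr_of_eventuallyEq ?_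
  filter_upwards [lt_mem_nhds hr] with x hx
  exact pderiv2_eq j (h.of_le (by norm_cast; omega)) hx

lemma pderiv2_continuousOn {F : ℝ → ℝ → ℝ} (j : ℕ)
    (h : ContDiffOn ℝ ((j + 1 : ℕ)) (fun p : ℝ × ℝ => F p.1 p.2) Etil) (s : ℝ) :
    ContinuousOn (fun r => pderiv2 j 1 F s r) (Set.Iio s) := by
  have hc : ContDiffOn ℝ ((0 + 1 : ℕ)) (D1^[j] (fun p : ℝ × ℝ => F p.1 p.2)) Etil := by
    apply contDiffOn_D1_iter
    convert h using 2
    ring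
  have h1 : ContinuousOn (fun r => D2 (D1^[j] (fun p : ℝ × ℝ => F p.1 p.2)) (s, r))
      (Set.Iio s) :=
    (contDiffOn_D2 hc).continuousOn.comp (by fun_prop) (fun x hx => hx)
  exact h1.congr (fun x hx => pderiv2_eq j h hx)

lemma cadlag_measurable {g : ℝ → ℝ} (hg : CadlagOn g) :
    Measurable (fun x => g (max x 0)) := by
  have hlim : ∀ x : ℝ, Tendsto (fun n : ℕ => ((⌊(n : ℝ) * x⌋ : ℝ) + 1) / n) atTop (𝓝[≥] x) := by
    intro x
    apply tendsto_nhdsWithin_of_tendsto_nhds_of_eventually_within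
    · have h0 : Tendsto (fun n : ℕ => x + 1 / (n : ℝ)) atTop (𝓝 x) := by
        simpa using (tendsto_const_nhds (x := x)).add tendsto_one_div_atTop_nhds_zero_nat
      apply tendsto_of_tendsto_of_tendsto_of_le_of_le' tendsto_const_nhds h0
      · filter_upwards [eventually_gt_atTop 0] with n hn
        have : (0 : ℝ) < n := by exact_mod_cast hn
        rw [le_div_iff₀ this]
        linarith [Int.lt_floor_add_one ((n : ℝ) * x)]
      · filter_upwards [eventually_gt_atTop 0] with n hn
        have : (0 : ℝ) < n := by exact_mod_cast hn
        rw [div_le_iff₀ this]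
        field_simp
        linarith [Int.floor_le ((n : ℝ) * x)]
    · filter_upwards [eventually_gt_atTop 0] with n hn
      have : (0 : ℝ) < n := by exact_mod_cast hn
      rw [mem_Ici, le_div_iff₀ this]
      linarith [Int.lt_floor_add_one ((n : ℝ) * x)]
  refine measurable_of_tendsto_metrizable
    (f := fun (n : ℕ) x => g (max (((⌊(n : ℝ) * x⌋ : ℝ) + 1) / n) 0)) ?_ ?_
  · intro n
    have h1 : Measurable (fun x : ℝ => ⌊(n : ℝ) * x⌋) :=
      Int.measurable_floor.comp (measurable_const_mul _)
    have h2 : Measurable (fun z : ℤ => g (max (((z : ℝ) + 1) / n) 0)) := measurable_from_top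
    exact h2.comp h1
  · rw [tendsto_pi_nhds]
    intro x
    have h1 := hg.1 (max x 0) (le_max_right _ _)
    refine h1.comp ?_
    apply tendsto_nhdsWithin_of_tendsto_nhds_of_eventually_within
    · have hc : Continuous (fun y : ℝ => max y 0) := by fun_prop
      exact hc.continuousAt.tendsto.comp ((hlim x).mono_right nhdsWithin_le_nhds)
    · have := (hlim x).eventually self_mem_nhdsWithin
      filter_upwards [this] with n hn
      exact max_le_max_right _ hn

lemma taylor_sum_hasDerivAt (c : ℕ → ℝ) (t x : ℝ) (m : ℕ) :
    HasDerivAt (fun x => ∑ j ∈ Finset.range (m + 1), c j * (x - t) ^ j / (j.factorial : ℝ))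
      (∑ j ∈ Finset.range m, c (j + 1) * (x - t) ^ j / (j.factorial : ℝ)) x := by
  have h0 : ∀ j ∈ Finset.range m, HasDerivAt
      (fun x => c (j + 1) * (x - t) ^ (j + 1) / ((j + 1).factorial : ℝ))
      (c (j + 1) * (x - t) ^ j / (j.factorial : ℝ)) x := by
    intro j _
    have h1 : HasDerivAt (fun x : ℝ => (x - t) ^ (j + 1)) (((j + 1 : ℕ) : ℝ) * (x - t) ^ j * 1) x := by
      exact ((hasDerivAt_id x).sub_const t).pow (j + 1)
    refine ((h1.const_mul (c (j + 1))).div_const ((j + 1).factorial : ℝ)).congr_deriv ?_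
    rw [Nat.factorial_succ]
    have : (j.factorial : ℝ) ≠ 0 := by positivity
    push_cast
    field_simp
  have h2 := (HasDerivAt.fun_sum h0).add_const (c 0 * (x - t) ^ 0 / ((0 : ℕ).factorial : ℝ))
  refine h2.congr_of_eventuallyEq (Eventually.of_forall fun y => ?_)
  simp only [Finset.sum_range_succ', pow_zero]

lemma taylor_bound (m : ℕ) : ∀ (H : ℕ → ℝ → ℝ) (t u B : ℝ),
    (∀ j < m, ∀ x ∈ Set.Icc t u, HasDerivAt (H j) (H (j + 1) x) x) →
    (∀ x ∈ Set.Icc t u, |H m x| ≤ B) → ∀ x ∈ Set.Icc t u,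
    |H 0 x - ∑ j ∈ Finset.range m, H j t * (x - t) ^ j / (j.factorial : ℝ)| ≤ B * (x - t) ^ m := by
  induction m with
  | zero => intro H t u B _ hB x hx; simpa using hB x hx
  | succ m ih =>
    intro H t u B hd hB x hx
    have ih' := ih (fun j => H (j + 1)) t u B (fun j hj x hx => hd (j + 1) (by omega) x hx) hB
    have hB0 : 0 ≤ B := (abs_nonneg _).trans (hB x hx)
    have hxt : 0 ≤ x - t := by linarith [hx.1]
    have hmvt := (convex_Icc t x).norm_image_sub_le_of_norm_hasDerivWithin_le
      (f := fun x => H 0 x - ∑ j ∈ Finset.range (m + 1), H j t * (x - t) ^ j / (j.factorial : ℝ))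
      (f' := fun x => H 1 x - ∑ j ∈ Finset.range m, H (j + 1) t * (x - t) ^ j / (j.factorial : ℝ))
      (C := B * (x - t) ^ m) (x := t) (y := x)
      (fun y hy => ((hd 0 (by omega) y ⟨hy.1, hy.2.trans hx.2⟩).sub
        (taylor_sum_hasDerivAt (fun j => H j t) t y m)).hasDerivWithinAt)
      (fun y hy => by
        rw [Real.norm_eq_abs]
        refine (ih' y ⟨hy.1, hy.2.trans hx.2⟩).trans ?_
        have := hy.1
        have := hy.2
        gcongr)
      (left_mem_Icc.2 hx.1) (right_mem_Icc.2 hx.1)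
    rw [Real.norm_eq_abs, Real.norm_eq_abs, abs_of_nonneg hxt] at hmvt
    have e : (H 0 t - ∑ j ∈ Finset.range (m + 1), H j t * (t - t) ^ j / (j.factorial : ℝ)) = 0 := by
      rw [Finset.sum_range_succ']
      simp
    simp only [e, sub_zero] at hmvt
    rw [pow_succ, ← mul_assoc]
    exact hmvt

lemma potter_fst {F : ℝ → ℝ → ℝ} {d : ℝ} {n : ℕ} (hF : SmoothVariation d (n + 1) F)
    {γ : ℝ} (hγ : γ < d) : ∃ h₀ > 0, ∀ r θ u : ℝ, r ∈ Set.Icc (0:ℝ) 2 → r < θ → θ ≤ u →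
      u - r < h₀ → F θ r ≤ F u r * ((θ - r) / (u - r)) ^ γ := by
  obtain ⟨h₀, hh₀, H⟩ := hF.condB (Set.Icc 0 2) isCompact_Icc (d - γ) (by linarith)
  refine ⟨h₀, hh₀, fun r θ u hr hθ hu hlt => ?_⟩
  have hder : ∀ s ∈ Set.Icc θ u, HasDerivAt (fun s => F s r * (s - r) ^ (-γ))
      (pderiv2 1 0 F s r * (s - r) ^ (-γ) + F s r * (1 * (-γ) * (s - r) ^ (-γ - 1))) s := by
    intro s hs
    have hrs : r < s := hθ.trans_le hs.1
    have h1 := hasDerivAt_D1 hF.mem.smooth hrs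
    have h2 : pderiv2 1 0 F s r = D1 (fun p : ℝ × ℝ => F p.1 p.2) (s, r) := by
      unfold pderiv2
      rw [iteratedDeriv_zero, iteratedDeriv_one]
      exact h1.deriv
    rw [h2]
    exact h1.mul (((hasDerivAt_id s).sub_const r).rpow_const (Or.inl (by simp; linarith)))
  have hmono : MonotoneOn (fun s => F s r * (s - r) ^ (-γ)) (Set.Icc θ u) := by
    apply monotoneOn_of_deriv_nonneg (convex_Icc _ _)
    · exact fun s hs => (hder s hs).continuousAt.continuousWithinAt
    · exact fun s hs => (hder s (interior_subset hs)).differentiableAt.differentiableWithinAt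
    · intro s hs
      have hs := interior_subset hs
      rw [(hder s hs).deriv]
      have hrs : 0 < s - r := by linarith [hs.1]
      have hpos : 0 < F s r := hF.mem.pos (s, r) (by show r < s; linarith)
      have hB := H (s - r) hrs (by linarith [hs.2]) r hr
      rw [add_sub_cancel] at hB
      have hB2 := (abs_lt.1 hB).1
      have hB3 : γ < (s - r) * pderiv2 1 0 F s r / F s r := by linarith
      rw [lt_div_iff₀ hpos] at hB3
      have e : (s - r) ^ (-γ) = (s - r) ^ (-γ - 1) * (s - r) := by
        rw [← Real.rpow_add_one hrs.ne']; ring_nf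
      rw [e]
      have : 0 ≤ (s - r) ^ (-γ - 1) * ((s - r) * pderiv2 1 0 F s r - γ * F s r) :=
        mul_nonneg (Real.rpow_nonneg hrs.le _) (by linarith)
      linarith
  have h3 := hmono (left_mem_Icc.2 hu) (right_mem_Icc.2 hu) hu
  have ha : 0 < θ - r := by linarith
  have hb : 0 < u - r := by linarith
  simp only at h3
  rw [Real.rpow_neg ha.le, Real.rpow_neg hb.le, ← div_eq_mul_inv, ← div_eq_mul_inv,
    div_le_iff₀ (Real.rpow_pos_of_pos ha _)] at h3
  rw [Real.div_rpow ha.le hb.le]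
  calc _ ≤ _ := h3
    _ = _ := by ring

lemma potter_snd {F : ℝ → ℝ → ℝ} {d : ℝ} {n : ℕ} (hF : SmoothVariation d (n + 1) F)
    {β : ℝ} (hβ : d < β) : ∃ h₀ > 0, ∀ r u v : ℝ, u ∈ Set.Icc (0:ℝ) 2 → r ≤ v → v < u →
      u - r < h₀ → F u r ≤ F u v * ((u - r) / (u - v)) ^ β := by
  obtain ⟨h₀, hh₀, H⟩ := hF.condA (Set.Icc 0 2) isCompact_Icc (β - d) (by linarith)
  refine ⟨h₀, hh₀, fun r u v hu hr hv hlt => ?_⟩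
  have hder : ∀ s ∈ Set.Icc r v, HasDerivAt (fun s => F u s * (u - s) ^ (-β))
      (pderiv2 0 1 F u s * (u - s) ^ (-β) + F u s * (-1 * (-β) * (u - s) ^ (-β - 1))) s := by
    intro s hs
    have hrs : s < u := hs.2.trans_lt hv
    have h1 := hasDerivAt_D2 hF.mem.smooth hrs
    have h2 : pderiv2 0 1 F u s = D2 (fun p : ℝ × ℝ => F p.1 p.2) (u, s) := by
      unfold pderiv2
      rw [iteratedDeriv_one]
      simp only [iteratedDeriv_zero]
      exact h1.deriv
    rw [h2]
    exact h1.mul (((hasDerivAt_id s).const_sub u).rpow_const (Or.inl (by simp; linarith)))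
  have hmono : MonotoneOn (fun s => F u s * (u - s) ^ (-β)) (Set.Icc r v) := by
    apply monotoneOn_of_deriv_nonneg (convex_Icc _ _)
    · exact fun s hs => (hder s hs).continuousAt.continuousWithinAt
    · exact fun s hs => (hder s (interior_subset hs)).differentiableAt.differentiableWithinAt
    · intro s hs
      have hs := interior_subset hs
      rw [(hder s hs).deriv]
      have hrs : 0 < u - s := by linarith [hs.2]
      have hpos : 0 < F u s := hF.mem.pos (u, s) (by show s < u; linarith)
      have hB := H (u - s) hrs (by linarith [hs.1]) u hu
      rw [sub_sub_cancel] at hB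
      have hB2 := (abs_lt.1 hB).1
      have hB3 : -β < (u - s) * pderiv2 0 1 F u s / F u s := by linarith
      rw [lt_div_iff₀ hpos] at hB3
      have e : (u - s) ^ (-β) = (u - s) ^ (-β - 1) * (u - s) := by
        rw [← Real.rpow_add_one hrs.ne']; ring_nf
      rw [e]
      have : 0 ≤ (u - s) ^ (-β - 1) * ((u - s) * pderiv2 0 1 F u s + β * F u s) :=
        mul_nonneg (Real.rpow_nonneg hrs.le _) (by linarith)
      linarith
  have h3 := hmono (left_mem_Icc.2 hr) (right_mem_Icc.2 hr) hr
  have ha : 0 < u - r := by linarith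
  have hb : 0 < u - v := by linarith
  simp only at h3
  rw [Real.rpow_neg ha.le, Real.rpow_neg hb.le, ← div_eq_mul_inv, ← div_eq_mul_inv,
    div_le_iff₀ (Real.rpow_pos_of_pos ha _)] at h3
  rw [Real.div_rpow ha.le hb.le]
  calc _ ≤ _ := h3
    _ = _ := by ring

lemma pderiv2_bound_one {F : ℝ → ℝ → ℝ} {d : ℝ} {n : ℕ} (hF : SmoothVariation d n F)
    (j : ℕ) (hj : j + 1 ≤ n) : ∃ M > 0, ∃ h₀ > 0, ∀ s r : ℝ, s ∈ Set.Icc (0:ℝ) 2 → r < s →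
      s - r < h₀ → |pderiv2 j 1 F s r| ≤ M * F s r / (s - r) ^ (j + 1) := by
  have key : ∃ c : ℝ, ∃ h₀ > 0, ∀ h : ℝ, 0 < h → h < h₀ → ∀ t ∈ Set.Icc (0:ℝ) 2,
      |h ^ (j + 1) * pderiv2 j 1 F t (t - h) / F t (t - h) + c| < 1 := by
    rcases Nat.eq_zero_or_pos j with rfl | hpos
    · obtain ⟨h₀, hh₀, H⟩ := hF.condA (Set.Icc 0 2) isCompact_Icc 1 one_pos
      exact ⟨d, h₀, hh₀, by simpa using H⟩
    · obtain ⟨h₀, hh₀, H⟩ := hF.condC (j + 1) (by omega) hj (Set.Icc 0 2) isCompact_Icc 1 one_pos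
      exact ⟨_, h₀, hh₀, H⟩
  obtain ⟨c, h₀, hh₀, H⟩ := key
  refine ⟨1 + |c|, by positivity, h₀, hh₀, fun s r hs hr hlt => ?_⟩
  have hsr : 0 < s - r := by linarith
  have h1 := H (s - r) hsr hlt s hs
  rw [sub_sub_cancel] at h1
  have hpos : 0 < F s r := hF.mem.pos (s, r) hr
  have h2 : |(s - r) ^ (j + 1) * pderiv2 j 1 F s r / F s r| ≤ 1 + |c| := by
    have := abs_sub_abs_le_abs_sub ((s - r) ^ (j + 1) * pderiv2 j 1 F s r / F s r) (-c)
    rw [abs_neg, sub_neg_eq_add] at this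
    linarith
  rw [abs_div, abs_mul, abs_of_pos hpos, abs_of_pos (pow_pos hsr (j + 1)), div_le_iff₀ hpos] at h2
  rw [le_div_iff₀ (pow_pos hsr _)]
  linarith

lemma pderiv2_bound {F : ℝ → ℝ → ℝ} {d : ℝ} {n : ℕ} (hF : SmoothVariation d n F)
    (N : ℕ) : N ≤ n → ∃ M > 0, ∃ h₀ > 0, ∀ j < N, ∀ s r : ℝ, s ∈ Set.Icc (0:ℝ) 2 → r < s →
      s - r < h₀ → |pderiv2 j 1 F s r| ≤ M * F s r / (s - r) ^ (j + 1) := by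
  induction N with
  | zero => intro _; exact ⟨1, one_pos, 1, one_pos, fun j hj => absurd hj (by omega)⟩
  | succ N ih =>
    intro hN
    obtain ⟨M₁, hM₁, h₁, hh₁, H₁⟩ := ih (by omega)
    obtain ⟨M₂, hM₂, h₂, hh₂, H₂⟩ := pderiv2_bound_one hF N hN
    refine ⟨max M₁ M₂, lt_max_of_lt_left hM₁, min h₁ h₂, lt_min hh₁ hh₂,
      fun j hj s r hs hr hlt => ?_⟩
    have hpos : 0 < F s r := hF.mem.pos (s, r) hr
    have hsr : 0 < s - r := by linarith
    rcases Nat.lt_succ_iff_lt_or_eq.1 hj with h | rfl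
    · refine (H₁ j h s r hs hr (hlt.trans_le (min_le_left _ _))).trans ?_
      gcongr
      exact le_max_left _ _
    · refine (H₂ s r hs hr (hlt.trans_le (min_le_right _ _))).trans ?_
      gcongr
      exact le_max_right _ _

lemma ineqA {δ y w α β η : ℝ} {J : ℕ} (hδ : 0 < δ) (hw : δ ≤ w) (hwy : w ≤ y)
    (h1 : β + η ≤ 1) (h2 : β + η + α - J - 1 ≤ 0) :
    (y / δ) ^ β / y ^ (J + 2) * w ^ J * y ^ α ≤ w ^ α * (δ ^ (η - 1) * y ^ (-1 - η)) := by
  obtain ⟨a, rfl⟩ : ∃ a, δ = Real.exp a := ⟨Real.log δ, (Real.exp_log hδ).symm⟩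
  obtain ⟨b, rfl⟩ : ∃ b, y = Real.exp b := ⟨Real.log y, (Real.exp_log (by linarith)).symm⟩
  obtain ⟨c, rfl⟩ : ∃ c, w = Real.exp c := ⟨Real.log w, (Real.exp_log (by linarith)).symm⟩
  rw [Real.exp_le_exp] at hw hwy
  simp only [← Real.exp_sub, ← Real.exp_mul, ← Real.exp_nat_mul, ← Real.exp_add]
  rw [Real.exp_le_exp]
  push_cast
  nlinarith [mul_nonneg (sub_nonneg.2 hwy) (sub_nonneg.2 h2),
    mul_nonneg (sub_nonneg.2 hw) (sub_nonneg.2 h1)]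

lemma ineqB1 {δ y w z α β η : ℝ} (hδ : 0 < δ) (hy : δ ≤ y) (hyw : y ≤ w) (hz : y ≤ z)
    (h1 : β + η ≤ 1) (h2 : β ≤ 1) (hα : 0 ≤ α) :
    (z / δ) ^ β / z ^ 2 * y ^ α ≤ w ^ α * (δ ^ (η - 1) * y ^ (-1 - η)) := by
  obtain ⟨a, rfl⟩ : ∃ a, δ = Real.exp a := ⟨Real.log δ, (Real.exp_log hδ).symm⟩
  obtain ⟨b, rfl⟩ : ∃ b, y = Real.exp b := ⟨Real.log y, (Real.exp_log (by linarith)).symm⟩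
  obtain ⟨c, rfl⟩ : ∃ c, w = Real.exp c := ⟨Real.log w, (Real.exp_log (by linarith)).symm⟩
  obtain ⟨e, rfl⟩ : ∃ e, z = Real.exp e := ⟨Real.log z, (Real.exp_log (by linarith)).symm⟩
  rw [Real.exp_le_exp] at hy hyw hz
  simp only [← Real.exp_sub, ← Real.exp_mul, ← Real.exp_nat_mul, ← Real.exp_add]
  rw [Real.exp_le_exp]
  push_cast
  nlinarith [mul_nonneg (sub_nonneg.2 hz) (sub_nonneg.2 h2),
    mul_nonneg (sub_nonneg.2 hy) (sub_nonneg.2 h1), mul_nonneg (sub_nonneg.2 hyw) hα]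

lemma ineqB2 {δ y w α β γ η : ℝ} {j : ℕ} (hδ : 0 < δ) (hy : δ ≤ y) (hyw : y ≤ w)
    (h1 : β + η ≤ 1) (h2 : (j : ℝ) + 1 ≤ γ + η + α) :
    (w / δ) ^ β * (y / w) ^ γ / y ^ (j + 2) * w ^ j * y ^ α
      ≤ w ^ α * (δ ^ (η - 1) * y ^ (-1 - η)) := by
  obtain ⟨a, rfl⟩ : ∃ a, δ = Real.exp a := ⟨Real.log δ, (Real.exp_log hδ).symm⟩
  obtain ⟨b, rfl⟩ : ∃ b, y = Real.exp b := ⟨Real.log y, (Real.exp_log (by linarith)).symm⟩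
  obtain ⟨c, rfl⟩ : ∃ c, w = Real.exp c := ⟨Real.log w, (Real.exp_log (by linarith)).symm⟩
  rw [Real.exp_le_exp] at hy hyw
  simp only [← Real.exp_sub, ← Real.exp_mul, ← Real.exp_nat_mul, ← Real.exp_add]
  rw [Real.exp_le_exp]
  push_cast
  nlinarith [mul_nonneg (sub_nonneg.2 hyw) (sub_nonneg.2 h2),
    mul_nonneg (sub_nonneg.2 (hy.trans hyw)) (sub_nonneg.2 h1)]

lemma rpow_two_bound {a b β : ℝ} (ha : 0 ≤ a) (hab : a ≤ 2 * b) (h0 : 0 ≤ β) (h1 : β ≤ 1) :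
    a ^ β ≤ 2 * b ^ β := by
  have hb : 0 ≤ b := by linarith
  calc a ^ β ≤ (2 * b) ^ β := Real.rpow_le_rpow ha hab h0
    _ = 2 ^ β * b ^ β := Real.mul_rpow (by norm_num) hb
    _ ≤ 2 * b ^ β := by
      gcongr
      calc (2 : ℝ) ^ β ≤ 2 ^ (1 : ℝ) := Real.rpow_le_rpow_of_exponent_le (by norm_num) h1
        _ = 2 := Real.rpow_one 2

lemma pointwise_bound {d α η M A t r u v : ℝ} {J : ℕ} (H : ℕ → ℝ → ℝ)
    (hα : 0 < α) (hη : 0 < η) (hηd : η ≤ d) (h1 : d + 2 * η ≤ 1)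
    (h2 : d + 2 * η + α - J - 1 ≤ 0) (hJ : (J : ℝ) ≤ d + α)
    (hM : 0 ≤ M) (hA : 0 ≤ A) (htv : t < v) (hvu : v < u) (hr : r ≤ t - (u - v))
    (hder : ∀ j ≤ J, ∀ x ∈ Set.Icc t u, HasDerivAt (H j) (H (j + 1) x) x)
    (hb : ∀ j ≤ J + 1, ∀ x ∈ Set.Icc t u, |H j x| ≤
      M * (A * ((u - r) / (u - v)) ^ (d + η) * ((x - r) / (u - r)) ^ (d - η))
        / (x - r) ^ (j + 1)) :
    |(H 0 u - ∑ j ∈ Finset.range (J + 1), H j t * (u - t) ^ j / (j.factorial : ℝ))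
      - (H 0 v - ∑ j ∈ Finset.range (J + 1), H j t * (v - t) ^ j / (j.factorial : ℝ))|
      * (t - r) ^ α ≤
    2 * M * (1 + J) * A * (u - t) ^ α * ((u - v) ^ η * (t - r) ^ (-1 - η)) := by
  set δ := u - v with hδdef
  set w := u - t with hwdef
  set y := t - r with hydef
  have hδ : 0 < δ := by linarith
  have hδw : δ ≤ w := by linarith
  have hδy : δ ≤ y := by linarith
  have hw : 0 < w := by linarith
  have hy : 0 < y := by linarith
  have hβ0 : 0 ≤ d + η := by linarith
  have hβ1 : d + η ≤ 1 := by linarith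
  have hγ0 : 0 ≤ d - η := by linarith
  have hur : 0 < u - r := by linarith
  have hya : 0 < y ^ α := Real.rpow_pos_of_pos hy _
  set R := w ^ α * (δ ^ (η - 1) * y ^ (-1 - η)) with hR
  have hR0 : 0 ≤ R := by positivity
  have hle1 : ∀ x ∈ Set.Icc t u, ((x - r) / (u - r)) ^ (d - η) ≤ 1 := by
    intro x hx
    apply Real.rpow_le_one
    · apply div_nonneg <;> linarith [hx.1]
    · rw [div_le_one hur]; linarith [hx.2]
    · exact hγ0
  have hb' : ∀ j ≤ J + 1, ∀ x ∈ Set.Icc t u, |H j x| ≤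
      M * (A * ((u - r) / δ) ^ (d + η)) / (x - r) ^ (j + 1) := by
    intro j hj x hx
    refine (hb j hj x hx).trans ?_
    have : 0 < x - r := by linarith [hx.1]
    have h3 : A * ((u - r) / δ) ^ (d + η) * ((x - r) / (u - r)) ^ (d - η)
        ≤ A * ((u - r) / δ) ^ (d + η) :=
      mul_le_of_le_one_right (by positivity) (hle1 x hx)
    gcongr
  have hderiv : ∀ x ∈ Set.Icc v u,
      |H 1 x - ∑ j ∈ Finset.range J, H (j + 1) t * (x - t) ^ j / (j.factorial : ℝ)| * y ^ α
        ≤ 2 * M * (1 + J) * A * R := by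
    intro x hx
    have hxt : x ∈ Set.Icc t u := ⟨by linarith [hx.1], hx.2⟩
    have hxw : x - t ≤ w := by linarith [hx.2]
    have hxt0 : 0 ≤ x - t := by linarith [hx.1]
    rcases le_total w y with hwy | hyw
    · have hB : ∀ x ∈ Set.Icc t u, |H (J + 1) x| ≤ M * (A * (2 * (y / δ) ^ (d + η))) / y ^ (J + 2) := by
        intro x hx
        refine (hb' (J + 1) le_rfl x hx).trans ?_
        have : y ≤ x - r := by linarith [hx.1]
        have h3 : ((u - r) / δ) ^ (d + η) ≤ 2 * (y / δ) ^ (d + η) := by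
          apply rpow_two_bound (by positivity) _ hβ0 hβ1
          rw [← mul_div_assoc]
          gcongr
          linarith
        gcongr
      have hT := taylor_bound J (fun j => H (j + 1)) t u _
        (fun j hj x hx => hder (j + 1) (by omega) x hx) hB x hxt
      have hA' := ineqA (J := J) (α := α) (β := d + η) (η := η) hδ hδw hwy (by linarith)
        (by linarith)
      calc _ ≤ (M * (A * (2 * (y / δ) ^ (d + η))) / y ^ (J + 2) * w ^ J) * y ^ α := by
            gcongr
            refine hT.trans ?_
            gcongr
        _ = 2 * M * A * ((y / δ) ^ (d + η) / y ^ (J + 2) * w ^ J * y ^ α) := by ring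
        _ ≤ 2 * M * A * R := by gcongr
        _ = 2 * M * 1 * A * R := by ring
        _ ≤ _ := by
          gcongr
          have : (0 : ℝ) ≤ J := by positivity
          linarith
    · have hB1 : |H 1 x| * y ^ α ≤ 2 * M * A * R := by
        have hz : y ≤ x - r := by linarith
        have h3 : ((u - r) / δ) ^ (d + η) ≤ 2 * ((x - r) / δ) ^ (d + η) := by
          apply rpow_two_bound (by positivity) _ hβ0 hβ1
          rw [← mul_div_assoc]
          gcongr
          linarith [hx.1]
        have h4 := ineqB1 (α := α) (β := d + η) (η := η) hδ hδy hyw hz (by linarith) hβ1 hα.le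
        have h5 : 0 < x - r := by linarith
        calc _ ≤ (M * (A * (2 * ((x - r) / δ) ^ (d + η))) / (x - r) ^ 2) * y ^ α := by
              gcongr
              refine (hb' 1 (by omega) x hxt).trans ?_
              gcongr
          _ = 2 * M * A * (((x - r) / δ) ^ (d + η) / (x - r) ^ 2 * y ^ α) := by ring
          _ ≤ _ := by gcongr
      have hB2 : ∀ j ∈ Finset.range J,
          |H (j + 1) t * (x - t) ^ j / (j.factorial : ℝ)| * y ^ α ≤ 2 * M * A * R := by
        intro j hj
        have hjJ := Finset.mem_range.1 hj
        have hjJ' : (j : ℝ) + 1 ≤ J := by exact_mod_cast hjJ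
        have h3 : ((u - r) / δ) ^ (d + η) ≤ 2 * (w / δ) ^ (d + η) := by
          apply rpow_two_bound (by positivity) _ hβ0 hβ1
          rw [← mul_div_assoc]
          gcongr
          linarith
        have h4 := ineqB2 (j := j) (α := α) (β := d + η) (γ := d - η) (η := η) hδ hδy hyw
          (by linarith) (by linarith)
        have h5 : ((t - r) / (u - r)) ^ (d - η) ≤ (y / w) ^ (d - η) := by
          rw [← hydef]
          gcongr
          linarith
        have hf1 : (1 : ℝ) ≤ j.factorial := by exact_mod_cast Nat.factorial_pos j
        have h6 : |H (j + 1) t * (x - t) ^ j / (j.factorial : ℝ)| ≤ |H (j + 1) t| * w ^ j := by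
          rw [abs_div, abs_mul, abs_of_nonneg (pow_nonneg hxt0 j),
            abs_of_pos (by linarith : (0 : ℝ) < j.factorial)]
          refine (div_le_self (by positivity) hf1).trans ?_
          gcongr
        calc _ ≤ (M * (A * (2 * (w / δ) ^ (d + η)) * (y / w) ^ (d - η)) / y ^ (j + 2) * w ^ j)
                  * y ^ α := by
              gcongr
              refine h6.trans ?_
              gcongr
              refine (hb (j + 1) (by omega) t ⟨le_rfl, by linarith⟩).trans ?_
              gcongr
          _ = 2 * M * A * ((w / δ) ^ (d + η) * (y / w) ^ (d - η) / y ^ (j + 2) * w ^ j * y ^ α) := by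
              ring
          _ ≤ _ := by gcongr
      calc _ ≤ (|H 1 x| + ∑ j ∈ Finset.range J, |H (j + 1) t * (x - t) ^ j / (j.factorial : ℝ)|)
                * y ^ α := by
            gcongr
            exact (abs_sub _ _).trans (by gcongr; exact Finset.abs_sum_le_sum_abs _ _)
        _ = |H 1 x| * y ^ α
            + ∑ j ∈ Finset.range J, |H (j + 1) t * (x - t) ^ j / (j.factorial : ℝ)| * y ^ α := by
            rw [add_mul, Finset.sum_mul]
        _ ≤ 2 * M * A * R + ∑ j ∈ Finset.range J, 2 * M * A * R := by
            exact add_le_add hB1 (Finset.sum_le_sum hB2)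
        _ = _ := by
            rw [Finset.sum_const, Finset.card_range, nsmul_eq_mul]
            ring
  have hmvt := (convex_Icc v u).norm_image_sub_le_of_norm_hasDerivWithin_le
      (f := fun x => H 0 x - ∑ j ∈ Finset.range (J + 1), H j t * (x - t) ^ j / (j.factorial : ℝ))
      (f' := fun x => H 1 x - ∑ j ∈ Finset.range J, H (j + 1) t * (x - t) ^ j / (j.factorial : ℝ))
      (C := 2 * M * (1 + J) * A * R / y ^ α) (x := v) (y := u)
      (fun x hx => ((hder 0 (by omega) x ⟨by linarith [hx.1], hx.2⟩).sub
        (taylor_sum_hasDerivAt (fun j => H j t) t x J)).hasDerivWithinAt)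
      (fun x hx => by
        rw [Real.norm_eq_abs, le_div_iff₀ hya]
        exact hderiv x hx)
      (left_mem_Icc.2 hvu.le) (right_mem_Icc.2 hvu.le)
  rw [Real.norm_eq_abs, Real.norm_eq_abs, ← hδdef, abs_of_pos hδ] at hmvt
  have e : δ ^ η = δ ^ (η - 1) * δ := by
    rw [← Real.rpow_add_one hδ.ne']; ring_nf
  calc _ ≤ (2 * M * (1 + J) * A * R / y ^ α * δ) * y ^ α := by gcongr
    _ = 2 * M * (1 + J) * A * R * δ := by field_simp
    _ = _ := by rw [hR, e]; ring

lemma gP_intervalIntegrable {g : ℝ → ℝ} (hg : CadlagOn g) (P : Polynomial ℝ) {a b K : ℝ}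
    (ha : 0 ≤ a) (hab : a ≤ b) (hK : ∀ r ∈ Set.Icc a b, |g r - P.eval r| ≤ K) :
    IntervalIntegrable (fun r => g r - P.eval r) volume a b := by
  rw [intervalIntegrable_iff_integrableOn_Icc_of_le hab]
  have hm : Measurable (fun r => g (max r 0) - P.eval r) :=
    (cadlag_measurable hg).sub P.continuous.measurable
  have h1 : IntegrableOn (fun r => g (max r 0) - P.eval r) (Set.Icc a b) volume := by
    apply Measure.integrableOn_of_bounded (M := K)
    · simp
    · exact hm.aestronglyMeasurable
    · refine (ae_restrict_iff' measurableSet_Icc).2 (Eventually.of_forall fun r hr => ?_)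
      rw [max_eq_left (ha.trans hr.1), Real.norm_eq_abs]
      exact hK r hr
  refine h1.congr_fun (fun r hr => ?_) measurableSet_Icc
  simp only [max_eq_left (ha.trans hr.1)]

lemma tail_integral_bound {t h δ η : ℝ} (hδ : 0 < δ) (hδh : δ ≤ h) (hη : 0 < η) :
    ∫ r in (t - h)..(t - δ), δ ^ η * (t - r) ^ (-1 - η) ≤ 1 / η := by
  rw [intervalIntegral.integral_const_mul,
    intervalIntegral.integral_comp_sub_left (fun x => x ^ (-1 - η)) t, sub_sub_cancel,
    sub_sub_cancel, integral_rpow (Or.inr ⟨by linarith, by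
      rw [Set.uIcc_of_le hδh]; exact fun h => by linarith [h.1]⟩)]
  have e : -1 - η + 1 = -η := by ring
  rw [e]
  have h1 : δ ^ η * δ ^ (-η) = 1 := by
    rw [← Real.rpow_add hδ]; simp
  have h2 : 0 ≤ δ ^ η * h ^ (-η) :=
    mul_nonneg (Real.rpow_nonneg hδ.le _) (Real.rpow_nonneg (hδ.le.trans hδh) _)
  have : δ ^ η * ((h ^ (-η) - δ ^ (-η)) / -η) = (1 - δ ^ η * h ^ (-η)) / η := by
    rw [← h1]; field_simp; ring
  rw [this]
  gcongr
  linarith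

/-- Lemma 6.3: bound on the middle part of `I₂,₁` up to a polynomial
correction, for points to the right of `t`. -/
theorem bound_I21_middle
    (d l : ℝ) (hd : d ∈ Set.Ioo (0:ℝ) 1) (hl : 0 < l)
    (F : ℝ → ℝ → ℝ) (hF : SmoothVariation d ((⌊l + d⌋).toNat + 2) F)
    (f : ℝ → ℝ → ℝ) (hf : f = pderiv2 0 1 F)
    (g : ℝ → ℝ) (hg : CadlagOn g)
    (t : ℝ) (ht : t ∈ Set.Ioo (0:ℝ) 1) (ε : ℝ) (hε : ε ∈ Set.Ioo (0:ℝ) l)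
    (P : Polynomial ℝ) (hP : (P.natDegree : ℤ) ≤ ⌊l⌋)
    (C₀ : ℝ) (hC₀ : 0 < C₀)
    (hgP : ∀ r ∈ Set.Icc (0:ℝ) 1, |g r - P.eval r| ≤ C₀ * |r - t| ^ (l - ε)) :
    ∃ h ∈ Set.Ioo (0:ℝ) t, ∃ C > 0, ∃ h' > 0, ∀ δ : ℝ, 0 < δ → δ < h' →
      ∃ P4 : Polynomial ℝ, (P4.natDegree : ℤ) ≤ ⌊l + d⌋ ∧
        ∀ u v : ℝ, u ∈ Set.Ioo t (t + h') → v ∈ Set.Ioo t (t + h') → u - v = δ →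
          |(∫ r in (t - h)..(t - δ), (f u r - f v r) * (g r - P.eval r))
              - P4.eval u + P4.eval v| ≤
            C * F u v * (|u - t| ^ (l - ε) + |v - t| ^ (l - ε)) := by
  subst hf
  obtain ⟨hd0, hd1⟩ := hd
  obtain ⟨ht0, ht1⟩ := ht
  obtain ⟨hε0, hεl⟩ := hε
  set n := (⌊l + d⌋).toNat with hn
  set α := l - ε with hαdef
  have hα : 0 < α := by linarith
  obtain ⟨J, hJdef⟩ : ∃ J : ℕ, J = ⌊α + d⌋.toNat := ⟨_, rfl⟩
  have hfl : (0 : ℤ) ≤ ⌊α + d⌋ := Int.floor_nonneg.2 (by linarith)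
  have hJz : (J : ℤ) = ⌊α + d⌋ := by rw [hJdef]; exact Int.toNat_of_nonneg hfl
  have hJr : (J : ℝ) = (⌊α + d⌋ : ℝ) := by exact_mod_cast congrArg (Int.cast (R := ℝ)) hJz
  have hJle : (J : ℝ) ≤ d + α := by rw [hJr]; linarith [Int.floor_le (α + d)]
  have hJlt : d + α < J + 1 := by rw [hJr]; linarith [Int.lt_floor_add_one (α + d)]
  have hJzn : (J : ℤ) ≤ ⌊l + d⌋ := by
    rw [hJz]; exact Int.floor_le_floor (by linarith)
  have hJn : J ≤ n := by omega
  obtain ⟨η, hη, hηd, hη1, hη2⟩ : ∃ η > 0, η ≤ d ∧ d + 2 * η ≤ 1 ∧ d + 2 * η + α - J - 1 ≤ 0 := by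
    refine ⟨min d (min ((1 - d) / 2) ((J + 1 - d - α) / 2)), ?_, min_le_left _ _, ?_, ?_⟩
    · refine lt_min hd0 (lt_min ?_ ?_) <;> linarith
    · have := (min_le_right d (min ((1 - d) / 2) ((J + 1 - d - α) / 2))).trans (min_le_left _ _)
      linarith
    · have := (min_le_right d (min ((1 - d) / 2) ((J + 1 - d - α) / 2))).trans (min_le_right _ _)
      linarith
  obtain ⟨h₁, hh₁, H₁⟩ := potter_fst (n := n + 1) hF (γ := d - η) (by linarith)
  obtain ⟨h₂, hh₂, H₂⟩ := potter_snd (n := n + 1) hF (β := d + η) (by linarith)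
  obtain ⟨M, hM, h₃, hh₃, H₃⟩ := pderiv2_bound hF (n + 2) le_rfl
  have hsm : ∀ j ≤ n + 2, ContDiffOn ℝ (j : ℕ) (fun p : ℝ × ℝ => F p.1 p.2) Etil :=
    fun j hj => hF.mem.smooth.of_le (by exact_mod_cast hj)
  obtain ⟨h, hh, hht, hhh₁, hhh₂, hhh₃⟩ :
      ∃ h > 0, h < t ∧ 2 * h ≤ h₁ ∧ 2 * h ≤ h₂ ∧ 2 * h ≤ h₃ := by
    refine ⟨min t (min h₁ (min h₂ h₃)) / 2, ?_, ?_, ?_, ?_, ?_⟩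
    · have : 0 < min t (min h₁ (min h₂ h₃)) := lt_min ht0 (lt_min hh₁ (lt_min hh₂ hh₃))
      linarith
    · have := min_le_left t (min h₁ (min h₂ h₃))
      linarith
    · have := (min_le_right t (min h₁ (min h₂ h₃))).trans (min_le_left _ _)
      linarith
    · have := ((min_le_right t (min h₁ (min h₂ h₃))).trans (min_le_right _ _)).trans
        (min_le_left _ _)
      linarith
    · have := ((min_le_right t (min h₁ (min h₂ h₃))).trans (min_le_right _ _)).trans
        (min_le_right _ _)
      linarith
  refine ⟨h, ⟨hh, hht⟩, C₀ * (2 * M * (1 + J)) * (1 / η), by positivity, h, hh, ?_⟩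
  intro δ hδ hδh
  have hab : t - h ≤ t - δ := by linarith
  have hGi : IntervalIntegrable (fun r => g r - P.eval r) volume (t - h) (t - δ) := by
    refine gP_intervalIntegrable hg P (K := C₀ * h ^ α) (by linarith) hab ?_
    intro r hr
    refine (hgP r ⟨by linarith [hr.1], by linarith [hr.2]⟩).trans ?_
    have : |r - t| ≤ h := abs_le.2 ⟨by linarith [hr.1], by linarith [hr.2]⟩
    gcongr
  have hint : ∀ j ≤ n + 1, ∀ s : ℝ, t ≤ s → IntervalIntegrable
      (fun r => pderiv2 j 1 F s r * (g r - P.eval r)) volume (t - h) (t - δ) := by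
    intro j hj s hs
    refine hGi.continuousOn_mul ?_
    rw [Set.uIcc_of_le hab]
    exact (pderiv2_continuousOn j (hsm (j + 1) (by omega)) s).mono
      (fun r hr => by rw [Set.mem_Iio]; linarith [hr.2])
  let I : ℕ → ℝ := fun j => ∫ r in (t - h)..(t - δ), pderiv2 j 1 F t r * (g r - P.eval r)
  refine ⟨∑ j ∈ Finset.range (J + 1),
    Polynomial.C (I j / (j.factorial : ℝ)) * (Polynomial.X - Polynomial.C t) ^ j, ?_, ?_⟩
  · refine le_trans ?_ hJzn
    norm_cast
    refine Polynomial.natDegree_sum_le_of_forall_le _ _ (fun j hj => ?_)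
    refine (Polynomial.natDegree_C_mul_le _ _).trans ?_
    refine (Polynomial.natDegree_pow_le).trans ?_
    rw [Polynomial.natDegree_X_sub_C, mul_one]
    exact Nat.lt_succ_iff.1 (Finset.mem_range.1 hj)
  intro u v hu hv huv
  have hint2 : ∀ x : ℝ, ∀ j ∈ Finset.range (J + 1), IntervalIntegrable
      (fun r => pderiv2 j 1 F t r * (x - t) ^ j / (j.factorial : ℝ) * (g r - P.eval r))
      volume (t - h) (t - δ) := by
    intro x j hj
    have hj' := Finset.mem_range.1 hj
    refine ((hint j (by omega) t le_rfl).const_mul ((x - t) ^ j / (j.factorial : ℝ))).congr ?_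
    intro r _
    ring
  have heval : ∀ x : ℝ, (∑ j ∈ Finset.range (J + 1),
      Polynomial.C (I j / (j.factorial : ℝ)) * (Polynomial.X - Polynomial.C t) ^ j).eval x
      = ∫ r in (t - h)..(t - δ), ∑ j ∈ Finset.range (J + 1),
        pderiv2 j 1 F t r * (x - t) ^ j / (j.factorial : ℝ) * (g r - P.eval r) := by
    intro x
    rw [intervalIntegral.integral_finsetSum (hint2 x), Polynomial.eval_finsetSum]
    refine Finset.sum_congr rfl (fun j _ => ?_)
    simp only [Polynomial.eval_mul, Polynomial.eval_C, Polynomial.eval_pow, Polynomial.eval_sub,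
      Polynomial.eval_X, I]
    rw [div_mul_eq_mul_div, mul_div_assoc, ← intervalIntegral.integral_mul_const]
    refine intervalIntegral.integral_congr (fun r _ => ?_)
    ring
  have hintS : ∀ x : ℝ, IntervalIntegrable (fun r => ∑ j ∈ Finset.range (J + 1),
        pderiv2 j 1 F t r * (x - t) ^ j / (j.factorial : ℝ) * (g r - P.eval r))
        volume (t - h) (t - δ) := by
    intro x
    have := IntervalIntegrable.sum (Finset.range (J + 1)) (hint2 x)
    refine this.congr ?_
    intro r _
    simp
  have hint0 : IntervalIntegrable
      (fun r => (pderiv2 0 1 F u r - pderiv2 0 1 F v r) * (g r - P.eval r))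
      volume (t - h) (t - δ) := by
    refine ((hint 0 (by omega) u hu.1.le).sub (hint 0 (by omega) v hv.1.le)).congr ?_
    intro r _
    simp only
    ring
  rw [heval u, heval v, ← intervalIntegral.integral_sub hint0 (hintS u),
    ← intervalIntegral.integral_add (hint0.sub (hintS u)) (hintS v)]
  have hA : 0 < F u v := hF.mem.pos (u, v) (by show v < u; linarith)
  have hbound : ∀ r ∈ Set.Icc (t - h) (t - δ),
      ‖(pderiv2 0 1 F u r - pderiv2 0 1 F v r) * (g r - P.eval r)
        - (∑ j ∈ Finset.range (J + 1),
          pderiv2 j 1 F t r * (u - t) ^ j / (j.factorial : ℝ) * (g r - P.eval r))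
        + ∑ j ∈ Finset.range (J + 1),
          pderiv2 j 1 F t r * (v - t) ^ j / (j.factorial : ℝ) * (g r - P.eval r)‖
      ≤ C₀ * (2 * M * (1 + J)) * F u v * (u - t) ^ α * (δ ^ η * (t - r) ^ (-1 - η)) := by
    intro r hr
    have hrt : r < t := by linarith [hr.2]
    have hp := pointwise_bound (d := d) (α := α) (η := η) (M := M) (A := F u v) (t := t) (r := r)
      (u := u) (v := v) (J := J) (fun j x => pderiv2 j 1 F x r) hα hη hηd hη1 hη2 hJle hM.le hA.le
      hv.1 (by linarith) (by linarith [hr.2])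
      (fun j hj x hx => pderiv2_hasDerivAt j (hsm (j + 2) (by omega)) (by linarith [hx.1]))
      (fun j hj x hx => by
        have hxr : 0 < x - r := by linarith [hx.1]
        refine (H₃ j (by omega) x r ⟨by linarith [hx.1], by linarith [hx.2, hu.2]⟩ (by linarith)
          (by linarith [hx.2, hu.2, hr.1])).trans ?_
        have e1 := H₁ r x u ⟨by linarith [hr.1], by linarith⟩ (by linarith) hx.2
          (by linarith [hu.2, hr.1])
        have e2 := H₂ r u v ⟨by linarith [hu.1], by linarith [hu.2]⟩ (by linarith [hv.1])
          (by linarith) (by linarith [hu.2, hr.1])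
        have hq : 0 ≤ ((x - r) / (u - r)) ^ (d - η) := by
          apply Real.rpow_nonneg
          apply div_nonneg <;> linarith [hx.2]
        have e3 := e1.trans (mul_le_mul_of_nonneg_right e2 hq)
        gcongr)
    rw [huv] at hp
    have hg' := hgP r ⟨by linarith [hr.1], by linarith⟩
    rw [abs_sub_comm r t, abs_of_pos (by linarith : 0 < t - r)] at hg'
    have e : (pderiv2 0 1 F u r - pderiv2 0 1 F v r) * (g r - P.eval r)
        - (∑ j ∈ Finset.range (J + 1),
          pderiv2 j 1 F t r * (u - t) ^ j / (j.factorial : ℝ) * (g r - P.eval r))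
        + ∑ j ∈ Finset.range (J + 1),
          pderiv2 j 1 F t r * (v - t) ^ j / (j.factorial : ℝ) * (g r - P.eval r)
        = ((pderiv2 0 1 F u r - ∑ j ∈ Finset.range (J + 1),
            pderiv2 j 1 F t r * (u - t) ^ j / (j.factorial : ℝ))
          - (pderiv2 0 1 F v r - ∑ j ∈ Finset.range (J + 1),
            pderiv2 j 1 F t r * (v - t) ^ j / (j.factorial : ℝ))) * (g r - P.eval r) := by
      rw [← Finset.sum_mul, ← Finset.sum_mul]
      ring
    rw [e, Real.norm_eq_abs, abs_mul]
    calc _ ≤ _ * (C₀ * (t - r) ^ α) := mul_le_mul_of_nonneg_left hg' (abs_nonneg _)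
      _ = C₀ * (_ * (t - r) ^ α) := by ring
      _ ≤ C₀ * _ := mul_le_mul_of_nonneg_left hp hC₀.le
      _ = _ := by ring
  have hint3 : IntervalIntegrable
      (fun r => C₀ * (2 * M * (1 + J)) * F u v * (u - t) ^ α * (δ ^ η * (t - r) ^ (-1 - η)))
      volume (t - h) (t - δ) := by
    apply ContinuousOn.intervalIntegrable
    rw [Set.uIcc_of_le hab]
    refine continuousOn_const.mul (continuousOn_const.mul ?_)
    refine ContinuousOn.rpow_const (by fun_prop) (fun r hr => Or.inl ?_)
    have := hr.2
    exact ne_of_gt (by linarith)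
  have hfin := intervalIntegral.norm_integral_le_of_norm_le hab
    (Eventually.of_forall fun r hr => hbound r (Set.Ioc_subset_Icc_self hr)) hint3
  rw [Real.norm_eq_abs] at hfin
  refine hfin.trans ?_
  rw [intervalIntegral.integral_const_mul]
  have hut : 0 < u - t := by linarith [hu.1]
  have htail := tail_integral_bound (t := t) hδ hδh.le hη
  calc _ ≤ C₀ * (2 * M * (1 + J)) * F u v * (u - t) ^ α * (1 / η) := by gcongr
    _ = C₀ * (2 * M * (1 + J)) * (1 / η) * F u v * (|u - t| ^ α + 0) := by
        rw [abs_of_pos hut]; ring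
    _ ≤ _ := by
        gcongr
        positivity
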